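/- Let g be a holomorphic function on D × Ω, where D ⊂ ℂ is an open disc {|ξ| < r} and Ω = {Y ∈ ℂⁿ : |Y| < R₀}, given by a convergent series g(ξ, Y) = Σ_{k ∈ ℕⁿ} g_k(ξ) Y^k with each ξ^{κ−1} g_k(ξ) holomorphic on D and |g_k(ξ)| ≤ K |ξ|^{1−κ} e^{c|ξ|^κ}/(R^{|k|} Γ(1/κ)) with R > R₀. Then there exist holomorphic functions aₘ(Y) on Ω, m ≥ 1, such that ξ^{κ−1} g(ξ, Y) = Σ_{m=1}^∞ aₘ(Y) ξ^{m−1} on D × Ω; in particular ξ^{κ−1} g(ξ, Y) extends holomorphically across ξ = 0 for each fixed Y ∈ Ω. -/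

import Mathlib

open Real Complex Metric

theorem aux_summable_geom (n : ℕ) (q : ℝ) (h0 : 0 ≤ q) (h1 : q < 1) :
    Summable (fun k : Fin n → ℕ => q ^ (∑ i, k i)) := by
  induction n with
  | zero => exact Summable.of_finite
  | succ n ih =>
    have h := (summable_geometric_of_lt_one h0 h1).mul_of_nonneg ih
      (fun _ => pow_nonneg h0 _) (fun _ => pow_nonneg h0 _)
    rw [← (Fin.consEquiv (fun _ : Fin (n+1) => ℕ)).summable_iff]
    refine h.congr fun x => ?_
    simp [Fin.consEquiv, Fin.sum_univ_succ, pow_add]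

theorem aux_monomial (n : ℕ) (k : Fin n → ℕ) (d : ℕ) :
    ∃ M : ContinuousMultilinearMap ℂ (fun _ : Fin d => Fin n → ℂ) ℂ,
      ‖M‖ ≤ 1 ∧ (∑ i, k i = d → ∀ Y, M (fun _ => Y) = ∏ i, Y i ^ k i) := by
  by_cases h : ∑ i, k i = d
  · subst h
    refine ⟨(ContinuousMultilinearMap.mkPiAlgebraFin ℂ _ ℂ).compContinuousLinearMap
      (fun j => ContinuousLinearMap.proj (R := ℂ) (φ := fun _ : Fin n => ℂ)
        ((finSigmaFinEquiv (n := k)).symm j).1), ?_, ?_⟩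
    · refine ContinuousMultilinearMap.opNorm_le_bound zero_le_one fun m => ?_
      simp only [ContinuousMultilinearMap.compContinuousLinearMap_apply,
        ContinuousMultilinearMap.mkPiAlgebraFin_apply, List.prod_ofFn, norm_prod, one_mul]
      exact Finset.prod_le_prod (fun _ _ => norm_nonneg _) (fun j _ => norm_le_pi_norm (m j) _)
    · intro _ Y
      simp only [ContinuousMultilinearMap.compContinuousLinearMap_apply,
        ContinuousMultilinearMap.mkPiAlgebraFin_apply, List.prod_ofFn,
        ContinuousLinearMap.proj_apply]
      rw [← (finSigmaFinEquiv (n := k)).prod_comp]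
      simp [Fintype.prod_sigma]
  · exact ⟨0, by simp, fun h' => absurd h' h⟩

theorem aux_norm_mono (n : ℕ) (k : Fin n → ℕ) (ρ : ℝ) (Y : Fin n → ℂ) (hY : ∀ i, ‖Y i‖ ≤ ρ) :
    ‖∏ i, Y i ^ k i‖ ≤ ρ ^ (∑ i, k i) := by
  rw [norm_prod, ← Finset.prod_pow_eq_pow_sum]
  refine Finset.prod_le_prod (fun _ _ => norm_nonneg _) fun i _ => ?_
  rw [norm_pow]
  exact pow_le_pow_left₀ (norm_nonneg _) (hY i) _

theorem aux_analytic (n : ℕ) (R₀ : ℝ) (hR₀ : 0 < R₀) (c : (Fin n → ℕ) → ℂ)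
    (hc : Summable fun k => ‖c k‖ * R₀ ^ (∑ i, k i)) :
    AnalyticOnNhd ℂ (fun Y : Fin n → ℂ => ∑' k, c k * ∏ i, Y i ^ k i)
      {Y : Fin n → ℂ | ∀ i, ‖Y i‖ < R₀} := by
  choose M hM1 hM2 using fun d k => aux_monomial n k d
  have fib : ∀ {E : Type} [NormedAddCommGroup E] [CompleteSpace E] (F : (Fin n → ℕ) → E) (s : E),
      HasSum F s → HasSum (fun d => ∑ k ∈ Finset.piAntidiag Finset.univ d, F k) s := by
    intro E _ _ F s h
    have h2 := h.tsum_fiberwise (fun k => ∑ i, k i)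
    refine h2.congr_fun ?_ |> fun h => h
    intro d
    have : (fun k : Fin n → ℕ => ∑ i, k i) ⁻¹' {d} =
        ((Finset.piAntidiag Finset.univ d : Finset (Fin n → ℕ)) : Set (Fin n → ℕ)) := by
      ext k; simp
    rw [this, Finset.tsum_subtype']
  let p : FormalMultilinearSeries ℂ (Fin n → ℂ) ℂ := fun d =>
    ∑ k ∈ Finset.piAntidiag Finset.univ d, c k • M d k
  have hball : HasFPowerSeriesOnBall (fun Y : Fin n → ℂ => ∑' k, c k * ∏ i, Y i ^ k i) p 0
      (ENNReal.ofReal R₀) := by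
    refine ⟨?_, by simpa using hR₀, ?_⟩
    · refine p.le_radius_of_summable ?_
      refine Summable.of_nonneg_of_le (fun _ => by positivity) (fun d => ?_)
        (fib _ _ hc.hasSum).summable
      rw [Real.coe_toNNReal _ hR₀.le]
      calc ‖p d‖ * R₀ ^ d ≤ (∑ k ∈ Finset.piAntidiag Finset.univ d, ‖c k‖) * R₀ ^ d := by
            gcongr
            refine norm_sum_le_of_le _ fun k _ => ?_
            rw [norm_smul]
            exact mul_le_of_le_one_right (norm_nonneg _) (hM1 d k)
        _ = _ := by
            rw [Finset.sum_mul]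
            refine Finset.sum_congr rfl fun k hk => ?_
            rw [Finset.mem_piAntidiag] at hk
            rw [hk.1]
    · intro Y hY
      rw [eball_ofReal, mem_ball_zero_iff] at hY
      have hs : Summable fun k : Fin n → ℕ => c k * ∏ i, Y i ^ k i := by
        refine Summable.of_norm_bounded hc fun k => ?_
        rw [norm_mul]
        gcongr
        exact aux_norm_mono n k R₀ Y fun i => (norm_le_pi_norm Y i).trans hY.le
      have := fib _ _ hs.hasSum
      rw [zero_add]
      convert this using 2 with d
      simp only [p, ContinuousMultilinearMap.sum_apply, ContinuousMultilinearMap.smul_apply,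
        smul_eq_mul]
      refine Finset.sum_congr rfl fun k hk => ?_
      rw [Finset.mem_piAntidiag] at hk
      rw [hM2 d k hk.1]
  intro Y hY
  refine hball.analyticOnNhd Y ?_
  rw [eball_ofReal, mem_ball_zero_iff]
  exact (pi_norm_lt_iff hR₀).2 hY

theorem stmt_7 (n : ℕ) (κ r R R₀ K c : ℝ) (hκ : 0 < κ) (hr : 0 < r)
    (hR₀ : 0 < R₀) (hRR : R₀ < R) (hK : 0 ≤ K) (hc : 0 ≤ c)
    (g : ℂ → (Fin n → ℂ) → ℂ) (gk : (Fin n → ℕ) → ℂ → ℂ)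
    (hhol : ∀ k : Fin n → ℕ, ∃ Gk : ℂ → ℂ, AnalyticOnNhd ℂ Gk (ball (0:ℂ) r) ∧
      ∀ ξ ∈ ball (0:ℂ) r, ξ ≠ 0 → Gk ξ = ξ ^ ((κ : ℂ) - 1) * gk k ξ)
    (hbound : ∀ k : Fin n → ℕ, ∀ ξ ∈ ball (0:ℂ) r, ξ ≠ 0 →
      ‖gk k ξ‖ ≤ K * ‖ξ‖ ^ ((1:ℝ) - κ) * Real.exp (c * ‖ξ‖ ^ κ)
        / (R ^ (∑ i, k i) * Real.Gamma (1 / κ)))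
    (hseries : ∀ ξ ∈ ball (0:ℂ) r, ξ ≠ 0 → ∀ Y : Fin n → ℂ, (∀ i, ‖Y i‖ < R₀) →
      HasSum (fun k : Fin n → ℕ => gk k ξ * ∏ i, Y i ^ k i) (g ξ Y)) :
    ∃ a : ℕ → (Fin n → ℂ) → ℂ,
      (∀ m : ℕ, AnalyticOnNhd ℂ (a m) {Y : Fin n → ℂ | ∀ i, ‖Y i‖ < R₀}) ∧
      (∀ ξ ∈ ball (0:ℂ) r, ξ ≠ 0 → ∀ Y : Fin n → ℂ, (∀ i, ‖Y i‖ < R₀) →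
        HasSum (fun m : ℕ => a m Y * ξ ^ m) (ξ ^ ((κ : ℂ) - 1) * g ξ Y)) ∧
      (∀ Y : Fin n → ℂ, (∀ i, ‖Y i‖ < R₀) →
        ∃ G : ℂ → ℂ, AnalyticOnNhd ℂ G (ball (0:ℂ) r) ∧
          ∀ ξ ∈ ball (0:ℂ) r, ξ ≠ 0 → G ξ = ξ ^ ((κ : ℂ) - 1) * g ξ Y) := by
  choose Gk hGa hGe using hhol
  have hR : 0 < R := hR₀.trans hRR
  have hΓ : 0 < Real.Gamma (1 / κ) := Real.Gamma_pos_of_pos (by positivity)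
  obtain ⟨B, hB0, hB⟩ : ∃ B : ℝ, 0 ≤ B ∧ ∀ k : Fin n → ℕ, ∀ ξ ∈ ball (0:ℂ) r, ξ ≠ 0 →
      ‖Gk k ξ‖ ≤ B / R ^ (∑ i, k i) := by
    refine ⟨K * Real.exp (c * r ^ κ) / Real.Gamma (1 / κ), by positivity, fun k ξ hξ h0 => ?_⟩
    have hn : 0 < ‖ξ‖ := norm_pos_iff.2 h0
    have hlt : ‖ξ‖ < r := by simpa using hξ
    rw [hGe k ξ hξ h0, norm_mul]
    have e1 : ‖ξ ^ ((κ : ℂ) - 1)‖ = ‖ξ‖ ^ (κ - 1) := by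
      have : ((κ : ℂ) - 1) = ((κ - 1 : ℝ) : ℂ) := by push_cast; ring
      rw [this, Complex.norm_cpow_real]
    have e2 : ‖ξ‖ ^ (κ - 1) * ‖ξ‖ ^ (1 - κ) = 1 := by
      rw [← Real.rpow_add hn]; simp
    rw [e1]
    calc ‖ξ‖ ^ (κ - 1) * ‖gk k ξ‖ ≤ ‖ξ‖ ^ (κ - 1) * (K * ‖ξ‖ ^ ((1:ℝ) - κ) *
          Real.exp (c * ‖ξ‖ ^ κ) / (R ^ (∑ i, k i) * Real.Gamma (1 / κ))) := by
            gcongr; exact hbound k ξ hξ h0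
      _ = (‖ξ‖ ^ (κ - 1) * ‖ξ‖ ^ ((1:ℝ) - κ)) * (K * Real.exp (c * ‖ξ‖ ^ κ)) /
            (R ^ (∑ i, k i) * Real.Gamma (1 / κ)) := by ring
      _ = K * Real.exp (c * ‖ξ‖ ^ κ) / Real.Gamma (1 / κ) / R ^ (∑ i, k i) := by
            rw [e2, one_mul, div_div, mul_comm (R ^ _)]
      _ ≤ _ := by gcongr
  let C : (Fin n → ℕ) → ℕ → ℂ := fun k m => ((m.factorial : ℂ))⁻¹ * iteratedDeriv m (Gk k) 0
  have hC : ∀ s, 0 < s → s < r → ∀ k m, ‖C k m‖ ≤ B / R ^ (∑ i, k i) / s ^ m := by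
    intro s hs hsr k m
    have hd : DiffContOnCl ℂ (Gk k) (ball 0 s) := by
      refine (DifferentiableOn.diffContOnCl_ball (U := ball 0 r) ?_ (closedBall_subset_ball hsr))
      exact (hGa k).differentiableOn
    have := norm_iteratedDeriv_le_of_forall_mem_sphere_norm_le (C := B / R ^ (∑ i, k i)) m hs hd
      (fun z hz => hB k z (sphere_subset_closedBall.trans (closedBall_subset_ball hsr) hz)
        (ne_of_mem_sphere hz hs.ne'))
    have hm : (0:ℝ) < m.factorial := by exact_mod_cast m.factorial_pos
    simp only [C, norm_mul, norm_inv, Complex.norm_natCast]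
    rw [inv_mul_le_iff₀ hm]
    refine this.trans (le_of_eq ?_)
    ring
  have hq : Summable (fun k : Fin n → ℕ => (R₀ / R) ^ (∑ i, k i)) :=
    aux_summable_geom n _ (by positivity) ((div_lt_one hR).2 hRR)
  have key : ∀ ξ ∈ ball (0:ℂ) r, ξ ≠ 0 → ∀ Y : Fin n → ℂ, (∀ i, ‖Y i‖ < R₀) →
        HasSum (fun m : ℕ => (∑' k, C k m * ∏ i, Y i ^ k i) * ξ ^ m)
          (ξ ^ ((κ : ℂ) - 1) * g ξ Y) := by
    intro ξ hξ h0 Y hY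
    have hn : 0 < ‖ξ‖ := norm_pos_iff.2 h0
    obtain ⟨s, hs1, hs2⟩ := exists_between (show ‖ξ‖ < r by simpa using hξ)
    have hs0 : 0 < s := hn.trans hs1
    have hbd : ∀ k m, ‖C k m * (∏ i, Y i ^ k i) * ξ ^ m‖ ≤
        (R₀ / R) ^ (∑ i, k i) * (B * (‖ξ‖ / s) ^ m) := by
      intro k m
      rw [norm_mul, norm_mul, norm_pow]
      calc _ ≤ B / R ^ (∑ i, k i) / s ^ m * R₀ ^ (∑ i, k i) * ‖ξ‖ ^ m := by
            gcongr
            · exact hC s hs0 hs2 k m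
            · exact aux_norm_mono n k R₀ Y fun i => (hY i).le
        _ = _ := by rw [div_pow, div_pow]; ring
    have hS : Summable (fun x : ℕ × (Fin n → ℕ) =>
        C x.2 x.1 * (∏ i, Y i ^ x.2 i) * ξ ^ x.1) := by
      have h1 := ((summable_geometric_of_lt_one (r := ‖ξ‖ / s) (by positivity)
        ((div_lt_one hs0).2 hs1)).mul_left B).mul_of_nonneg hq
        (fun _ => by positivity) (fun _ => by positivity)
      refine Summable.of_norm_bounded h1 fun x => ?_
      rw [mul_comm (B * _)]
      exact hbd x.2 x.1
    have hT : HasSum (fun k : Fin n → ℕ => Gk k ξ * ∏ i, Y i ^ k i)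
        (ξ ^ ((κ : ℂ) - 1) * g ξ Y) := by
      have := (hseries ξ hξ h0 Y hY).mul_left (ξ ^ ((κ : ℂ) - 1))
      refine this.congr_fun ?_ |> fun h => h
      intro k
      rw [hGe k ξ hξ h0]; ring
    have hS' := (Equiv.prodComm (Fin n → ℕ) ℕ).summable_iff.2 hS
    have hrow : ∀ k, HasSum (fun m => C k m * (∏ i, Y i ^ k i) * ξ ^ m)
        (Gk k ξ * ∏ i, Y i ^ k i) := by
      intro k
      have := (Complex.hasSum_taylorSeries_on_ball (hGa k).differentiableOn hξ).mul_right
        (∏ i, Y i ^ k i)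
      have e : (fun m => C k m * (∏ i, Y i ^ k i) * ξ ^ m) = fun m : ℕ =>
          ((m.factorial : ℂ)⁻¹ • (ξ - 0) ^ m • iteratedDeriv m (Gk k) 0) * ∏ i, Y i ^ k i := by
        funext m
        simp only [C, sub_zero, smul_eq_mul]; ring
      rw [e]
      exact this
    have hval : HasSum (fun x : (Fin n → ℕ) × ℕ =>
        C x.1 x.2 * (∏ i, Y i ^ x.1 i) * ξ ^ x.2) (ξ ^ ((κ : ℂ) - 1) * g ξ Y) := by
      have h2 := hS'.hasSum.prod_fiberwise hrow
      rw [hT.unique h2]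
      exact hS'.hasSum
    have hval' : HasSum (fun x : ℕ × (Fin n → ℕ) =>
        C x.2 x.1 * (∏ i, Y i ^ x.2 i) * ξ ^ x.1) (ξ ^ ((κ : ℂ) - 1) * g ξ Y) :=
      (Equiv.prodComm (Fin n → ℕ) ℕ).hasSum_iff.1 hval
    refine hval'.prod_fiberwise fun m => ?_
    have := (hS.prod_factor m).hasSum
    dsimp only at this ⊢
    rw [tsum_mul_right] at this
    exact this
  refine ⟨fun m Y => ∑' k, C k m * ∏ i, Y i ^ k i, fun m => ?_, key, fun Y hY => ?_⟩
  · apply aux_analytic n R₀ hR₀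
    refine Summable.of_nonneg_of_le (fun _ => by positivity) (fun k => ?_)
      (hq.mul_left (B / (r/2) ^ m))
    calc _ ≤ B / R ^ (∑ i, k i) / (r/2) ^ m * R₀ ^ (∑ i, k i) := by
          gcongr; exact hC (r/2) (by linarith) (by linarith) k m
      _ = _ := by rw [div_pow R₀]; ring
  · let G : ℂ → ℂ := fun ξ => ∑' k : Fin n → ℕ, Gk k ξ * ∏ i, Y i ^ k i
    have hd : DifferentiableOn ℂ G (ball 0 r) := by
      refine differentiableOn_tsum_of_summable_norm (u := fun k => B * (R₀ / R) ^ (∑ i, k i))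
        (hq.mul_left B) (fun k => (hGa k).differentiableOn.mul_const _) isOpen_ball ?_
      intro k ξ hξ
      have hB' : ‖Gk k ξ‖ ≤ B / R ^ (∑ i, k i) := by
        by_cases h0 : ξ = 0
        · subst h0
          have := hC (r/2) (by linarith) (by linarith) k 0
          simpa [C] using this
        · exact hB k ξ hξ h0
      rw [norm_mul]
      calc _ ≤ B / R ^ (∑ i, k i) * R₀ ^ (∑ i, k i) := by
            gcongr
            exact aux_norm_mono n k R₀ Y fun i => (hY i).le
        _ = _ := by rw [div_pow]; ring
    refine ⟨G, hd.analyticOnNhd isOpen_ball, fun ξ hξ h0 => ?_⟩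
    have := (hseries ξ hξ h0 Y hY).mul_left (ξ ^ ((κ : ℂ) - 1))
    rw [← this.tsum_eq]
    refine tsum_congr fun k => ?_
    rw [hGe k ξ hξ h0]; ring
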